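/- arXiv:2307.15103 — 2 statements merged into one kernel-verified Lean document; each statement's English description precedes it below -/
import Mathlib

section
/- The Lane–Emden equation x''(t) + (2/t)x'(t) + 1 = 0 on the interval I = (1,∞) is not Ulam stable on (1,∞); that is, no Ulam constant exists for it on (1,∞). -/
open Set

/-- `L` is an Ulam constant for the scalar equation
`α(t) x'' + β(t) x' + γ(t) x = f(t)` on the (open) interval `I`. -/
def IsUlamConstant (I : Set ℝ) (α β γ f : ℝ → ℝ) (L : ℝ) : Prop :=
  0 < L ∧ ∀ ε > 0, ∀ ξ ξd ξdd : ℝ → ℝ,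
    (∀ t ∈ I, HasDerivAt ξ (ξd t) t) →
    (∀ t ∈ I, HasDerivAt ξd (ξdd t) t) →
    ContinuousOn ξdd I →
    (∀ t ∈ I, |α t * ξdd t + β t * ξd t + γ t * ξ t - f t| ≤ ε) →
    ∃ x xd xdd : ℝ → ℝ,
      (∀ t ∈ I, HasDerivAt x (xd t) t) ∧
      (∀ t ∈ I, HasDerivAt xd (xdd t) t) ∧
      ContinuousOn xdd I ∧
      (∀ t ∈ I, α t * xdd t + β t * xd t + γ t * x t = f t) ∧
      ∀ t ∈ I, |ξ t - x t| ≤ L * ε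

theorem eq_of_hasDerivAt_zero_of_one_lt {u : ℝ → ℝ} (hu : ∀ t ∈ Ioi (1 : ℝ), HasDerivAt u 0 t)
    {s t : ℝ} (hs : 1 < s) (ht : 1 < t) : u s = u t :=
  isOpen_Ioi.is_const_of_deriv_eq_zero isPreconnected_Ioi
    (fun r hr => (hu r hr).differentiableAt.differentiableWithinAt)
    (fun r hr => (hu r hr).deriv) hs ht

/-- Every solution of `x'' + (2/t)x' + 1 = 0` on `(1,∞)` is of the form `d - t²/6 - c/t`. -/
theorem exists_eq_of_lane_emden {x xd xdd : ℝ → ℝ}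
    (hx : ∀ t ∈ Ioi (1 : ℝ), HasDerivAt x (xd t) t)
    (hxd : ∀ t ∈ Ioi (1 : ℝ), HasDerivAt xd (xdd t) t)
    (heq : ∀ t ∈ Ioi (1 : ℝ), xdd t + 2 / t * xd t = -1) :
    ∃ c d : ℝ, ∀ t ∈ Ioi (1 : ℝ), x t = d - t ^ 2 / 6 - c / t := by
  have hu : ∀ t ∈ Ioi (1 : ℝ), HasDerivAt (fun s => s ^ 2 * xd s + s ^ 3 / 3) 0 t := by
    intro t ht
    have ht0 : t ≠ 0 := (zero_lt_one.trans ht).ne'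
    have h := ((hasDerivAt_pow 2 t).mul (hxd t ht)).add ((hasDerivAt_pow 3 t).div_const 3)
    refine h.congr_deriv ?_
    have h2 : xdd t = -1 - 2 / t * xd t := by linarith [heq t ht]
    rw [h2]
    push_cast
    field_simp
    ring
  obtain ⟨c, hc⟩ : ∃ c : ℝ, ∀ t ∈ Ioi (1 : ℝ), t ^ 2 * xd t + t ^ 3 / 3 = c :=
    ⟨_, fun t ht => eq_of_hasDerivAt_zero_of_one_lt hu ht one_lt_two⟩
  have hv : ∀ t ∈ Ioi (1 : ℝ), HasDerivAt (fun s => x s + s ^ 2 / 6 + c * s⁻¹) 0 t := by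
    intro t ht
    have ht0 : t ≠ 0 := (zero_lt_one.trans ht).ne'
    have h := ((hx t ht).add ((hasDerivAt_pow 2 t).div_const 6)).add
      ((hasDerivAt_inv ht0).const_mul c)
    refine h.congr_deriv ?_
    rw [← hc t ht]
    push_cast
    field_simp
    ring
  refine ⟨c, x 2 + 2 ^ 2 / 6 + c * 2⁻¹, fun t ht => ?_⟩
  have h := eq_of_hasDerivAt_zero_of_one_lt hv ht one_lt_two
  rw [← h]
  ring

/-- the Lane–Emden equation `x'' + (2/t)x' + 1 = 0` is not Ulam
stable on `(1,∞)`. -/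
theorem lane_emden_not_ulam_stable_on_Ioi_one :
    ¬ ∃ L, IsUlamConstant (Ioi 1) (fun _ => 1) (fun t => 2 / t)
      (fun _ => 0) (fun _ => -1) L := by
  rintro ⟨L, hL, h⟩
  obtain ⟨x, xd, xdd, hx, hxd, -, heq, hb⟩ := h 1 one_pos (fun _ => 0) (fun _ => 0) (fun _ => 0)
    (fun t _ => hasDerivAt_const t 0) (fun t _ => hasDerivAt_const t 0) continuousOn_const
    (fun t _ => by norm_num)
  obtain ⟨c, d, hcd⟩ := exists_eq_of_lane_emden hx hxd
    (fun t ht => by simpa using heq t ht)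
  obtain ⟨t, ht⟩ : ∃ t, t = 6 * (|d| + |c| + L) + 6 := ⟨_, rfl⟩
  have ht1 : 1 < t := by linarith [abs_nonneg d, abs_nonneg c]
  have hxt := (abs_le.1 (hb t ht1)).2
  rw [hcd t ht1] at hxt
  have hct : -|c| ≤ c / t :=
    neg_le_of_abs_le (by rw [abs_div, abs_of_pos (zero_lt_one.trans ht1)]
                         exact div_le_self (abs_nonneg c) ht1.le)
  nlinarith [le_abs_self d]
end

section
/- For any τ with 0 ≤ τ < ∞, the Lane–Emden equation x''(t) + (2/t)x'(t) + x(t) = 0 on the interval I = (τ,∞) is not Ulam stable on (τ,∞); that is, no Ulam constant exists for it on (τ,∞). -/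
open Set

/-- For a solution `x` of the Lane–Emden equation, `u = t x` satisfies `u'' + u = 0`, so its energy
`u² + u'²` is conserved. In particular `t x(t)` is bounded. -/
lemma exists_forall_sq_mul_le_of_lane_emden {τ : ℝ} (hτ : 0 ≤ τ) {x xd xdd : ℝ → ℝ}
    (hx : ∀ t ∈ Ioi τ, HasDerivAt x (xd t) t)
    (hxd : ∀ t ∈ Ioi τ, HasDerivAt xd (xdd t) t)
    (h : ∀ t ∈ Ioi τ, xdd t + 2 / t * xd t + x t = 0) :
    ∃ C : ℝ, ∀ t ∈ Ioi τ, (t * x t) ^ 2 ≤ C := by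
  have hE : ∀ t ∈ Ioi τ,
      HasDerivAt (fun t => (t * x t) ^ 2 + (x t + t * xd t) ^ 2) 0 t := by
    intro t ht
    have ht0 : t ≠ 0 := (hτ.trans_lt ht).ne'
    have hu := (hasDerivAt_id' t).fun_mul (hx t ht)
    have hv := (hx t ht).fun_add ((hasDerivAt_id' t).fun_mul (hxd t ht))
    refine ((hu.fun_pow 2).fun_add (hv.fun_pow 2)).congr_deriv ?_
    have key : t * xdd t + 2 * xd t + t * x t = 0 := by
      have := h t ht
      field_simp at this
      linarith
    push_cast
    linear_combination 2 * (x t + t * xd t) * key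
  have hmem : τ + 1 ∈ Ioi τ := lt_add_one τ
  refine ⟨((τ + 1) * x (τ + 1)) ^ 2 + (x (τ + 1) + (τ + 1) * xd (τ + 1)) ^ 2, fun t ht => ?_⟩
  have hconst := isOpen_Ioi.is_const_of_deriv_eq_zero isPreconnected_Ioi
    (fun s hs => (hE s hs).differentiableAt.differentiableWithinAt)
    (fun s hs => (hE s hs).deriv) ht hmem
  rw [← hconst]
  exact le_add_of_nonneg_right (sq_nonneg _)

/-- for `0 ≤ τ < ∞`, the Lane–Emden equation
`x'' + (2/t)x' + x = 0` is not Ulam stable on `(τ,∞)`. -/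
theorem lane_emden_not_ulam_stable_on_Ioi (τ : ℝ) (hτ : 0 ≤ τ) :
    ¬ ∃ L, IsUlamConstant (Ioi τ) (fun _ => 1) (fun t => 2 / t)
      (fun _ => 1) (fun _ => 0) L := by
  rintro ⟨L, -, hL⟩
  obtain ⟨x, xd, xdd, hx, hxd, -, heq, hclose⟩ := hL 6 (by norm_num)
    (fun t => t * Real.sin t) (fun t => Real.sin t + t * Real.cos t)
    (fun t => 2 * Real.cos t - t * Real.sin t)
    (fun t _ => ((hasDerivAt_id' t).fun_mul (Real.hasDerivAt_sin t)).congr_deriv (by ring))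
    (fun t _ => ((Real.hasDerivAt_sin t).fun_add
      ((hasDerivAt_id' t).fun_mul (Real.hasDerivAt_cos t))).congr_deriv (by ring))
    (by fun_prop) (by
      intro t ht
      have ht0 : 0 < t := hτ.trans_lt ht
      have hsin : |Real.sin t / t| ≤ 1 := by
        rw [abs_div, abs_of_pos ht0, div_le_one ht0]
        simpa [abs_of_pos ht0] using Real.abs_sin_le_abs (x := t)
      have hrw : 1 * (2 * Real.cos t - t * Real.sin t) + 2 / t * (Real.sin t + t * Real.cos t)
          + 1 * (t * Real.sin t) - 0 = 4 * Real.cos t + 2 * (Real.sin t / t) := by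
        field_simp
        ring
      rw [hrw, abs_le]
      have hcos := abs_le.1 (Real.abs_cos_le_one t)
      have hsin := abs_le.1 hsin
      constructor <;> linarith)
  obtain ⟨C, hC⟩ := exists_forall_sq_mul_le_of_lane_emden hτ hx hxd
    (fun t ht => by simpa using heq t ht)
  obtain ⟨n, hn⟩ := exists_nat_gt (τ + 1 + L * 6 + (C + 1))
  have hC0 : 0 ≤ C := (sq_nonneg _).trans (hC (τ + 1) (lt_add_one τ))
  have hL0 : 0 ≤ L * 6 := (abs_nonneg _).trans (hclose (τ + 1) (lt_add_one τ))
  set t : ℝ := Real.pi / 2 + n * (2 * Real.pi) with ht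
  have hnt : (n : ℝ) ≤ t := by
    nlinarith [Real.pi_gt_three, (Nat.cast_nonneg n : (0 : ℝ) ≤ n)]
  have hmem : t ∈ Ioi τ := by
    rw [mem_Ioi]
    linarith
  have hsin : Real.sin t = 1 := by
    rw [ht, Real.sin_add_nat_mul_two_pi, Real.sin_pi_div_two]
  have hxt := hclose t hmem
  simp only [hsin, mul_one] at hxt
  have hlt : C + 1 < x t := by linarith [(abs_le.1 hxt).2]
  have ht1 : 1 ≤ t := by linarith
  have hle : C + 1 ≤ t * x t := by nlinarith
  nlinarith [hC t hmem]
end
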